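/- arXiv:2311.06585 — 3 statements merged into one kernel-verified Lean document; each statement's English description precedes it below -/
import Mathlib

section
/- Let n, m, s be positive integers, let f : ℝⁿ × ℝᵐ → ℝⁿ be continuous, let φ : ℝⁿ → ℝˢ be a function, let t_c < t_f be real numbers, and let V : ℝ × ℝⁿ → ℝ be continuously differentiable. Assume (i) for all t ∈ [t_c, t_f], all x ∈ ℝⁿ and all u ∈ ℝᵐ, ∂V/∂t(t,x) + ⟨∇ₓV(t,x), f(x,u)⟩ ≤ ‖u‖², and (ii) V(t_f, x) = 0 for every x ∈ ℝⁿ with φ(x) = 0. Then for every continuous control u : [t_c, t_f] → ℝᵐ and every differentiable trajectory x : [t_c, t_f] → ℝⁿ satisfying x'(t) = f(x(t), u(t)) for all t ∈ [t_c, t_f], x(t_c) = x_c and φ(x(t_f)) = 0, the control effort satisfies ∫_{t_c}^{t_f} ‖u(t)‖² dt ≥ −V(t_c, x_c). -/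
/-- **Verification theorem (lower bound) for the minimum-effort control problem.**
If `V` is a continuously differentiable function satisfying the Hamilton–Jacobi–Bellman
inequality `∂V/∂t(t,x) + ⟨∇ₓV(t,x), f(x,u)⟩ ≤ ‖u‖²` for all `t ∈ [t_c, t_f]`, `x`, `u`
(here expressed as the derivative of `V` along the direction `(1, f x u)`), and
`V(t_f, x) = 0` whenever `φ x = 0`, then every admissible pair (continuous control `u`,
differentiable trajectory `x` with `x' = f(x,u)`, `x t_c = x_c`, `φ (x t_f) = 0`) has
control effort `∫_{t_c}^{t_f} ‖u t‖² dt ≥ -V(t_c, x_c)`. -/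
theorem stmt_0 (n m s : ℕ) (hn : 0 < n) (hm : 0 < m) (hs : 0 < s)
    (f : EuclideanSpace ℝ (Fin n) → EuclideanSpace ℝ (Fin m) → EuclideanSpace ℝ (Fin n))
    (hf : Continuous fun p : EuclideanSpace ℝ (Fin n) × EuclideanSpace ℝ (Fin m) =>
      f p.1 p.2)
    (φ : EuclideanSpace ℝ (Fin n) → EuclideanSpace ℝ (Fin s))
    (t_c t_f : ℝ) (htc : t_c < t_f)
    (V : ℝ × EuclideanSpace ℝ (Fin n) → ℝ) (hV : ContDiff ℝ 1 V)
    (hHJB : ∀ t ∈ Set.Icc t_c t_f, ∀ (x : EuclideanSpace ℝ (Fin n))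
      (u : EuclideanSpace ℝ (Fin m)), fderiv ℝ V (t, x) (1, f x u) ≤ ‖u‖ ^ 2)
    (hVf : ∀ x : EuclideanSpace ℝ (Fin n), φ x = 0 → V (t_f, x) = 0)
    (x_c : EuclideanSpace ℝ (Fin n)) :
    ∀ (u : ℝ → EuclideanSpace ℝ (Fin m)) (x : ℝ → EuclideanSpace ℝ (Fin n)),
      Continuous u →
      (∀ t ∈ Set.Icc t_c t_f, HasDerivAt x (f (x t) (u t)) t) →
      x t_c = x_c → φ (x t_f) = 0 →
      (∫ t in t_c..t_f, ‖u t‖ ^ 2) ≥ -V (t_c, x_c) := by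
  intro u x hu hx hxc hxf
  have hderiv : ∀ t ∈ Set.Icc t_c t_f,
      HasDerivAt (fun τ => V (τ, x τ)) (fderiv ℝ V (t, x t) (1, f (x t) (u t))) t := by
    intro t ht
    exact ((hV.differentiable one_ne_zero).differentiableAt.hasFDerivAt (x := (t, x t))).comp_hasDerivAt
      t ((hasDerivAt_id t).prodMk (hx t ht))
  have hle := intervalIntegral.sub_le_integral_of_hasDeriv_right_of_le htc.le
    (fun t ht => (hderiv t ht).continuousAt.continuousWithinAt)
    (fun t ht => (hderiv t (Set.Ioo_subset_Icc_self ht)).hasDerivWithinAt)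
    (φ := fun t => ‖u t‖ ^ 2) (hu.norm.pow 2).continuousOn.integrableOn_Icc
    (fun t ht => hHJB t (Set.Ioo_subset_Icc_self ht) (x t) (u t))
  simp only [hVf _ hxf, hxc] at hle
  linarith
end

section
/- Let n, m, s be positive integers, let f : ℝⁿ × ℝᵐ → ℝⁿ be continuous, let φ : ℝⁿ → ℝˢ be a function, let t_c < t_f be real numbers, and let V : ℝ × ℝⁿ → ℝ be continuously differentiable. Assume (i) for all t ∈ [t_c, t_f], all x ∈ ℝⁿ and all u ∈ ℝᵐ, ∂V/∂t(t,x) + ⟨∇ₓV(t,x), f(x,u)⟩ ≤ ‖u‖², and (ii) V(t_f, x) = 0 for every x ∈ ℝⁿ with φ(x) = 0. Suppose u* : [t_c, t_f] → ℝᵐ is a continuous control and x* : [t_c, t_f] → ℝⁿ a differentiable trajectory with (x*)'(t) = f(x*(t), u*(t)), x*(t_c) = x_c, φ(x*(t_f)) = 0, such that for all t ∈ [t_c, t_f] equality holds in (i) along the pair: ∂V/∂t(t, x*(t)) + ⟨∇ₓV(t, x*(t)), f(x*(t), u*(t))⟩ = ‖u*(t)‖². Then ∫_{t_c}^{t_f}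 ‖u*(t)‖² dt = −V(t_c, x_c), and consequently ∫_{t_c}^{t_f} ‖u*(t)‖² dt ≤ ∫_{t_c}^{t_f} ‖u(t)‖² dt for every continuous control u and differentiable trajectory x with x'(t) = f(x(t), u(t)), x(t_c) = x_c and φ(x(t_f)) = 0; i.e., the pair (x*, u*) is optimal for the MECP. -/
/-- The chain rule for a differentiable function of time and state along a trajectory. -/
theorem hasDerivAt_comp_trajectory {E : Type*} [NormedAddCommGroup E] [NormedSpace ℝ E]
    {V : ℝ × E → ℝ} {x : ℝ → E} {v : E} {t : ℝ}
    (hV : DifferentiableAt ℝ V (t, x t)) (hx : HasDerivAt x v t) :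
    HasDerivAt (fun τ => V (τ, x τ)) (fderiv ℝ V (t, x t) (1, v)) t :=
  hV.hasFDerivAt.comp_hasDerivAt t ((hasDerivAt_id t).prodMk hx)

/-- **Verification theorem (sufficiency) for the minimum-effort control problem.**
Under the Hamilton–Jacobi–Bellman inequality (i) and the terminal condition (ii) on `V`,
an admissible pair `(x*, u*)` along which equality holds in (i) achieves control effort
exactly `-V(t_c, x_c)`, and is consequently optimal: its effort is no larger than that
of any other admissible pair. -/
theorem stmt_1 (n m s : ℕ) (hn : 0 < n) (hm : 0 < m) (hs : 0 < s)
    (f : EuclideanSpace ℝ (Fin n) → EuclideanSpace ℝ (Fin m) → EuclideanSpace ℝ (Fin n))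
    (hf : Continuous fun p : EuclideanSpace ℝ (Fin n) × EuclideanSpace ℝ (Fin m) =>
      f p.1 p.2)
    (φ : EuclideanSpace ℝ (Fin n) → EuclideanSpace ℝ (Fin s))
    (t_c t_f : ℝ) (htc : t_c < t_f)
    (V : ℝ × EuclideanSpace ℝ (Fin n) → ℝ) (hV : ContDiff ℝ 1 V)
    (hHJB : ∀ t ∈ Set.Icc t_c t_f, ∀ (x : EuclideanSpace ℝ (Fin n))
      (u : EuclideanSpace ℝ (Fin m)), fderiv ℝ V (t, x) (1, f x u) ≤ ‖u‖ ^ 2)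
    (hVf : ∀ x : EuclideanSpace ℝ (Fin n), φ x = 0 → V (t_f, x) = 0)
    (x_c : EuclideanSpace ℝ (Fin n))
    (ustar : ℝ → EuclideanSpace ℝ (Fin m)) (hustar : Continuous ustar)
    (xstar : ℝ → EuclideanSpace ℝ (Fin n))
    (hxstar : ∀ t ∈ Set.Icc t_c t_f, HasDerivAt xstar (f (xstar t) (ustar t)) t)
    (hxstarc : xstar t_c = x_c) (hxstarf : φ (xstar t_f) = 0)
    (heq : ∀ t ∈ Set.Icc t_c t_f,
      fderiv ℝ V (t, xstar t) (1, f (xstar t) (ustar t)) = ‖ustar t‖ ^ 2) :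
    (∫ t in t_c..t_f, ‖ustar t‖ ^ 2) = -V (t_c, x_c) ∧
    ∀ (u : ℝ → EuclideanSpace ℝ (Fin m)) (x : ℝ → EuclideanSpace ℝ (Fin n)),
      Continuous u →
      (∀ t ∈ Set.Icc t_c t_f, HasDerivAt x (f (x t) (u t)) t) →
      x t_c = x_c → φ (x t_f) = 0 →
      (∫ t in t_c..t_f, ‖ustar t‖ ^ 2) ≤ ∫ t in t_c..t_f, ‖u t‖ ^ 2 := by
  have hVd : Differentiable ℝ V := hV.differentiable one_ne_zero
  have hstar : (∫ t in t_c..t_f, ‖ustar t‖ ^ 2) = -V (t_c, x_c) := by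
    rw [intervalIntegral.integral_eq_sub_of_hasDerivAt (f := fun t => V (t, xstar t))
      (f' := fun t => ‖ustar t‖ ^ 2) _
      ((hustar.norm.pow 2).intervalIntegrable _ _), hVf _ hxstarf, hxstarc, zero_sub]
    intro t ht
    rw [Set.uIcc_of_le htc.le] at ht
    exact heq t ht ▸ hasDerivAt_comp_trajectory (hVd _) (hxstar t ht)
  refine ⟨hstar, fun u x hu hx hxc hxf => ?_⟩
  have hderiv : ∀ t ∈ Set.Icc t_c t_f,
      HasDerivAt (fun τ => V (τ, x τ)) (fderiv ℝ V (t, x t) (1, f (x t) (u t))) t :=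
    fun t ht => hasDerivAt_comp_trajectory (hVd _) (hx t ht)
  have h := intervalIntegral.sub_le_integral_of_hasDeriv_right_of_le htc.le
    (fun t ht => (hderiv t ht).continuousAt.continuousWithinAt)
    (fun t ht => (hderiv t (Set.Ioo_subset_Icc_self ht)).hasDerivWithinAt)
    (hu.norm.pow 2).continuousOn.integrableOn_Icc
    (fun t ht => hHJB t (Set.Ioo_subset_Icc_self ht) (x t) (u t))
  rwa [hVf _ hxf, hxc, zero_sub, ← hstar] at h
end

section
/- Let n, m be positive integers, let f : ℝⁿ × ℝᵐ → ℝⁿ be continuously differentiable, and let V : ℝ × ℝⁿ → ℝ be twice continuously differentiable. Assume the Hamilton–Jacobi–Bellman inequality: for all t ∈ ℝ, x ∈ ℝⁿ, u ∈ ℝᵐ, ∂V/∂t(t,x) + ⟨∇ₓV(t,x), f(x,u)⟩ − ‖u‖² ≤ 0. Let I be an open interval, u* : I → ℝᵐ a control, and x : I → ℝⁿ a differentiable trajectory with x'(t) = f(x(t), u*(t)) for all t ∈ I, such that equality holds along the trajectory: ∂V/∂t(t, x(t)) + ⟨∇ₓV(t, x(t)), f(x(t), u*(t))⟩ − ‖u*(t)‖²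 = 0 for all t ∈ I. Then the costate p(t) := ∇ₓV(t, x(t)) is differentiable on I and satisfies the adjoint equation p'(t) = −(D_x f(x(t), u*(t)))ᵀ p(t) for all t ∈ I; equivalently, ṗ = −∂H/∂x(x(t), p(t), u*(t)) where H(x,p,u) = ⟨p, f(x,u)⟩ − ‖u‖². -/
section Costate

variable {E : Type*} [NormedAddCommGroup E] [InnerProductSpace ℝ E] {V : ℝ × E → ℝ}

/-- First-order condition in the state variable at a point where the Hamilton–Jacobi–Bellman
expression is maximal, for a vector field `g` (the dynamics with a frozen control). -/
theorem fderiv_fderiv_add_eq_zero_of_isLocalMax (hV : ContDiff ℝ 2 V) {g : E → E} {t c : ℝ}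
    {y : E} (hg : DifferentiableAt ℝ g y)
    (hmax : IsLocalMax (fun z => fderiv ℝ V (t, z) (1, g z) - c) y) (h : E) :
    fderiv ℝ (fderiv ℝ V) (t, y) (0, h) (1, g y) +
      fderiv ℝ V (t, y) (0, fderiv ℝ g y h) = 0 := by
  have hD : Differentiable ℝ (fderiv ℝ V) :=
    (hV.fderiv_right (m := 1) (by norm_num)).differentiable (by norm_num)
  have hslice : HasFDerivAt (fun z : E => (t, z)) (ContinuousLinearMap.inr ℝ ℝ E) y :=
    hasFDerivAt_prodMk_right t y
  have h₁ := HasFDerivAt.comp (G := ℝ × E →L[ℝ] ℝ) y (hD (t, y)).hasFDerivAt hslice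
  have h₂ : HasFDerivAt (fun z => ((1 : ℝ), g z))
      ((0 : E →L[ℝ] ℝ).prod (fderiv ℝ g y)) y :=
    (hasFDerivAt_const (1 : ℝ) y).prodMk hg.hasFDerivAt
  have hzero := hmax.hasFDerivAt_eq_zero ((h₁.clm_apply h₂).sub_const c)
  simpa [add_comm] using DFunLike.congr_fun hzero h

variable [CompleteSpace E]

theorem gradient_partial_eq (hV : Differentiable ℝ V) (t : ℝ) (y : E) :
    gradient (fun z => V (t, z)) y =
      (InnerProductSpace.toDual ℝ E).symm
        ((fderiv ℝ V (t, y)).comp (ContinuousLinearMap.inr ℝ ℝ E)) := by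
  have h : HasFDerivAt (fun z => V (t, z))
      ((fderiv ℝ V (t, y)).comp (ContinuousLinearMap.inr ℝ ℝ E)) y :=
    (hV (t, y)).hasFDerivAt.comp y (hasFDerivAt_prodMk_right t y)
  rw [gradient, h.fderiv]

theorem hasDerivAt_gradient_along (hV : ContDiff ℝ 2 V) {x : ℝ → E} {v : E} {t : ℝ}
    (hx : HasDerivAt x v t) :
    HasDerivAt (fun τ => gradient (fun y => V (τ, y)) (x τ))
      ((InnerProductSpace.toDual ℝ E).symm
        ((fderiv ℝ (fderiv ℝ V) (t, x t) (1, v)).comp (ContinuousLinearMap.inr ℝ ℝ E))) t := by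
  have hD : Differentiable ℝ (fderiv ℝ V) :=
    (hV.fderiv_right (m := 1) (by norm_num)).differentiable (by norm_num)
  have hcurve : HasDerivAt (fun τ => fderiv ℝ V (τ, x τ))
      (fderiv ℝ (fderiv ℝ V) (t, x t) (1, v)) t :=
    HasFDerivAt.comp_hasDerivAt (f := fun τ => (τ, x τ)) (l := fderiv ℝ V) t
      (hD (t, x t)).hasFDerivAt ((hasDerivAt_id t).prodMk hx)
  have hcomp := hcurve.clm_comp (hasDerivAt_const t (ContinuousLinearMap.inr ℝ ℝ E))
  rw [ContinuousLinearMap.comp_zero, add_zero] at hcomp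
  simp only [gradient_partial_eq (hV.differentiable (by norm_num))]
  exact (InnerProductSpace.toDual ℝ E).symm.toContinuousLinearEquiv.hasFDerivAt.comp_hasDerivAt
    t hcomp

end Costate

/-- **The costate equation from the Hamilton–Jacobi–Bellman equation.**
If `V` is twice continuously differentiable and satisfies the HJB inequality
`∂V/∂t(t,x) + ⟨∇ₓV(t,x), f(x,u)⟩ - ‖u‖² ≤ 0` everywhere (expressed via the derivative
of `V` along `(1, f x u)`), and equality holds along a trajectory `x` of
`x' = f(x, u*)` on an open interval `I = (a, b)`, then the costate
`p(t) := ∇ₓV(t, x(t))` is differentiable on `I` and satisfies the adjoint equation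
`p'(t) = -(Dₓf(x(t), u*(t)))ᵀ p(t)`, where the transpose is the Hilbert-space adjoint. -/
theorem stmt_2 (n m : ℕ) (hn : 0 < n) (hm : 0 < m)
    (f : EuclideanSpace ℝ (Fin n) → EuclideanSpace ℝ (Fin m) → EuclideanSpace ℝ (Fin n))
    (hf : ContDiff ℝ 1 (fun p : EuclideanSpace ℝ (Fin n) × EuclideanSpace ℝ (Fin m) =>
      f p.1 p.2))
    (V : ℝ × EuclideanSpace ℝ (Fin n) → ℝ) (hV : ContDiff ℝ 2 V)
    (hHJB : ∀ (t : ℝ) (x : EuclideanSpace ℝ (Fin n)) (u : EuclideanSpace ℝ (Fin m)),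
      fderiv ℝ V (t, x) (1, f x u) - ‖u‖ ^ 2 ≤ 0)
    (a b : ℝ)
    (ustar : ℝ → EuclideanSpace ℝ (Fin m))
    (x : ℝ → EuclideanSpace ℝ (Fin n))
    (hx : ∀ t ∈ Set.Ioo a b, HasDerivAt x (f (x t) (ustar t)) t)
    (heq : ∀ t ∈ Set.Ioo a b,
      fderiv ℝ V (t, x t) (1, f (x t) (ustar t)) - ‖ustar t‖ ^ 2 = 0) :
    ∀ t ∈ Set.Ioo a b,
      HasDerivAt (fun τ : ℝ => gradient (fun y => V (τ, y)) (x τ))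
        (-(ContinuousLinearMap.adjoint (fderiv ℝ (fun y => f y (ustar t)) (x t)))
          (gradient (fun y => V (t, y)) (x t))) t := by
  intro t ht
  have hg : DifferentiableAt ℝ (fun y => f y (ustar t)) (x t) :=
    ((hf.differentiable (by norm_num)).comp
      (differentiable_id.prodMk (differentiable_const (ustar t)))) (x t)
  have hmax : IsLocalMax
      (fun y => fderiv ℝ V (t, y) (1, f y (ustar t)) - ‖ustar t‖ ^ 2) (x t) :=
    Filter.Eventually.of_forall fun y => (hHJB t y (ustar t)).trans (heq t ht).ge
  have hsymm : IsSymmSndFDerivAt ℝ V (t, x t) :=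
    hV.contDiffAt.isSymmSndFDerivAt (by simp)
  refine (hasDerivAt_gradient_along hV (hx t ht)).congr_deriv (Eq.symm ?_)
  refine ext_inner_right ℝ fun h => ?_
  have hfoc := fderiv_fderiv_add_eq_zero_of_isLocalMax hV hg hmax h
  rw [inner_neg_left, ContinuousLinearMap.adjoint_inner_left,
    gradient_partial_eq (hV.differentiable (by norm_num)),
    InnerProductSpace.toDual_symm_apply, InnerProductSpace.toDual_symm_apply]
  simp only [ContinuousLinearMap.comp_apply, ContinuousLinearMap.inr_apply]
  rw [hsymm.eq (1, f (x t) (ustar t)) (0, h)]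
  linarith
end
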